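/- arXiv:1609.01927 — 5 statements merged into one kernel-verified Lean document; each statement's English description precedes it below -/
import Mathlib

section
/- Let (X,d) be a metric space that is p-convex for some p ∈ [1,∞). Then for any x, y, z, w ∈ X, any midpoint m₁ of x and y, and any midpoint m₂ of z and w, one has d(m₁, m₂) ≤ ((1/4)·(d(x,z)^p + d(x,w)^p + d(y,z)^p + d(y,w)^p))^{1/p}. -/
/-- If (X,d) is p-convex for some p ∈ [1,∞), then for any x, y, z, w ∈ X, any
midpoint m₁ of x and y and any midpoint m₂ of z and w,
d(m₁,m₂) ≤ ((1/4)(d(x,z)^p + d(x,w)^p + d(y,z)^p + d(y,w)^p))^(1/p). -/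
theorem stmt_1 {X : Type*} [MetricSpace X] (p : ℝ) (hp : 1 ≤ p)
    (hconv : ∀ x y z m : X, dist x m = dist x y / 2 → dist y m = dist x y / 2 →
      dist m z ≤ (1 / 2 : ℝ) ^ (1 / p) * (dist x z ^ p + dist y z ^ p) ^ (1 / p))
    (x y z w m₁ m₂ : X)
    (hm1x : dist x m₁ = dist x y / 2) (hm1y : dist y m₁ = dist x y / 2)
    (hm2z : dist z m₂ = dist z w / 2) (hm2w : dist w m₂ = dist z w / 2) :
    dist m₁ m₂ ≤
      ((1 / 4 : ℝ) * (dist x z ^ p + dist x w ^ p + dist y z ^ p + dist y w ^ p)) ^ (1 / p) := by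
  have hp0 : 0 < p := by linarith
  have key : ∀ x y z m : X, dist x m = dist x y / 2 → dist y m = dist x y / 2 →
      dist m z ^ p ≤ (1 / 2 : ℝ) * (dist x z ^ p + dist y z ^ p) := by
    intro x y z m h1 h2
    have h := hconv x y z m h1 h2
    have hs : 0 ≤ dist x z ^ p + dist y z ^ p := by positivity
    rw [← Real.mul_rpow (by norm_num) hs] at h
    have h3 := Real.rpow_le_rpow dist_nonneg h hp0.le
    rwa [one_div p, Real.rpow_inv_rpow (by positivity) hp0.ne'] at h3
  have a := key x y m₂ m₁ hm1x hm1y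
  have b := key z w x m₂ hm2z hm2w
  have c := key z w y m₂ hm2z hm2w
  rw [dist_comm m₂ x, dist_comm z x, dist_comm w x] at b
  rw [dist_comm m₂ y, dist_comm z y, dist_comm w y] at c
  rw [one_div p]
  refine (Real.le_rpow_inv_iff_of_pos dist_nonneg (by positivity) hp0).2 ?_
  linarith
end

section
/- Let (X,d) be a metric space carrying a map Q : X × X × [0,1] → X, written Q_t(x,y), satisfying the CAT(0) inequality. Then for all a, b, c, e ∈ X and all t ∈ [0,1], d(Q_t(a,b), Q_t(c,e))² ≤ t²·d(a,c)² + (1−t)²·d(b,e)² + t(1−t)·( d(a,e)² + d(b,c)² − d(c,e)² − d(a,b)² ). -/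
/-- If Q satisfies the CAT(0) inequality, then for all a, b, c, e ∈ X and t ∈ [0,1],
d(Q_t(a,b), Q_t(c,e))² ≤ t²d(a,c)² + (1-t)²d(b,e)² + t(1-t)(d(a,e)² + d(b,c)² - d(c,e)² - d(a,b)²). -/
theorem stmt_5 {X : Type*} [MetricSpace X] (Q : X → X → ℝ → X)
    (hQ : ∀ (x y z : X) (t : ℝ), 0 ≤ t → t ≤ 1 →
      dist (Q x y t) z ^ 2 ≤ t * dist z x ^ 2 + (1 - t) * dist z y ^ 2 - t * (1 - t) * dist x y ^ 2)
    (a b c e : X) (t : ℝ) (ht0 : 0 ≤ t) (ht1 : t ≤ 1) :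
    dist (Q a b t) (Q c e t) ^ 2 ≤
      t ^ 2 * dist a c ^ 2 + (1 - t) ^ 2 * dist b e ^ 2 +
        t * (1 - t) * (dist a e ^ 2 + dist b c ^ 2 - dist c e ^ 2 - dist a b ^ 2) := by
  have h1 := hQ a b (Q c e t) t ht0 ht1
  have h2 := mul_le_mul_of_nonneg_left (hQ c e a t ht0 ht1) ht0
  have h3 := mul_le_mul_of_nonneg_left (hQ c e b t ht0 ht1) (sub_nonneg.mpr ht1)
  linarith
end

section
/- Let (X,d) be a metric space carrying a map Q : X × X × [0,1] → X satisfying the CAT(0) inequality, and let S, T : X → X satisfy d(Sx,Sy) ≤ K_S·d(x,y) and d(Tx,Ty) ≤ K_T·d(x,y) for all x, y ∈ X, where K_S, K_T > 0. Then for all p, q, x, y ∈ X and t ∈ [0,1], d(Q_t(Sp,Tx), Q_t(Sq,Ty))² ≤ (t²K_S² + (1−t)²K_T²)·max(d(p,q)², d(x,y)²) + t(1−t)·( d(Sp,Ty) + d(Sq,Ty) + d(Tx,Sq) + d(Sp,Tx) )·min( K_S·d(p,q), K_T·d(x,y) ). -/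
/-- Proposition 3.1 (i). -/
theorem stmt_6 {X : Type*} [MetricSpace X] (Q : X → X → ℝ → X)
    (hQ : ∀ (x y z : X) (t : ℝ), 0 ≤ t → t ≤ 1 →
      dist (Q x y t) z ^ 2 ≤ t * dist z x ^ 2 + (1 - t) * dist z y ^ 2 - t * (1 - t) * dist x y ^ 2)
    (S T : X → X) (KS KT : ℝ) (hKS : 0 < KS) (hKT : 0 < KT)
    (hS : ∀ x y : X, dist (S x) (S y) ≤ KS * dist x y)
    (hT : ∀ x y : X, dist (T x) (T y) ≤ KT * dist x y)
    (p q x y : X) (t : ℝ) (ht0 : 0 ≤ t) (ht1 : t ≤ 1) :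
    dist (Q (S p) (T x) t) (Q (S q) (T y) t) ^ 2 ≤
      (t ^ 2 * KS ^ 2 + (1 - t) ^ 2 * KT ^ 2) * max (dist p q ^ 2) (dist x y ^ 2) +
        t * (1 - t) *
          (dist (S p) (T y) + dist (S q) (T y) + dist (T x) (S q) + dist (S p) (T x)) *
          min (KS * dist p q) (KT * dist x y) := by
  have ht2 : 0 ≤ 1 - t := by linarith
  have hS1 := hS p q
  have hT1 := hT x y
  have h1 := hQ (S p) (T x) (Q (S q) (T y) t) t ht0 ht1
  have h2 := hQ (S q) (T y) (S p) t ht0 ht1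
  have h3 := hQ (S q) (T y) (T x) t ht0 ht1
  have a1 := dist_triangle (S p) (S q) (T y)
  have a2 := dist_triangle (T x) (S p) (S q)
  have a3 := dist_triangle (S p) (T x) (T y)
  have a4 := dist_triangle (T x) (T y) (S q)
  rw [dist_comm (T x) (S p)] at a2
  rw [dist_comm (T y) (S q)] at a4
  have n1 : 0 ≤ dist (S p) (T y) := dist_nonneg
  have n2 : 0 ≤ dist (S q) (T y) := dist_nonneg
  have n3 : 0 ≤ dist (T x) (S q) := dist_nonneg
  have n4 : 0 ≤ dist (S p) (T x) := dist_nonneg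
  have n5 : 0 ≤ dist (S p) (S q) := dist_nonneg
  have n6 : 0 ≤ dist (T x) (T y) := dist_nonneg
  have b1 : dist (S p) (S q) ^ 2 ≤ KS ^ 2 * max (dist p q ^ 2) (dist x y ^ 2) := by
    calc dist (S p) (S q) ^ 2 ≤ (KS * dist p q) ^ 2 := by gcongr
      _ = KS ^ 2 * dist p q ^ 2 := by ring
      _ ≤ _ := by gcongr; exact le_max_left _ _
  have b2 : dist (T x) (T y) ^ 2 ≤ KT ^ 2 * max (dist p q ^ 2) (dist x y ^ 2) := by
    calc dist (T x) (T y) ^ 2 ≤ (KT * dist x y) ^ 2 := by gcongr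
      _ = KT ^ 2 * dist x y ^ 2 := by ring
      _ ≤ _ := by gcongr; exact le_max_right _ _
  have key : dist (S p) (T y) ^ 2 + dist (T x) (S q) ^ 2 - dist (S p) (T x) ^ 2
      - dist (S q) (T y) ^ 2 ≤
      (dist (S p) (T y) + dist (S q) (T y) + dist (T x) (S q) + dist (S p) (T x)) *
          min (KS * dist p q) (KT * dist x y) := by
    rcases min_choice (KS * dist p q) (KT * dist x y) with h | h <;> rw [h]
    · have c1 : dist (S p) (T y) - dist (S q) (T y) ≤ KS * dist p q := by linarith
      have c2 : dist (T x) (S q) - dist (S p) (T x) ≤ KS * dist p q := by linarith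
      have d1 := mul_le_mul_of_nonneg_left c1 (add_nonneg n1 n2)
      have d2 := mul_le_mul_of_nonneg_left c2 (add_nonneg n3 n4)
      linarith
    · have c1 : dist (S p) (T y) - dist (S p) (T x) ≤ KT * dist x y := by linarith
      have c2 : dist (T x) (S q) - dist (S q) (T y) ≤ KT * dist x y := by linarith
      have d1 := mul_le_mul_of_nonneg_left c1 (add_nonneg n1 n4)
      have d2 := mul_le_mul_of_nonneg_left c2 (add_nonneg n3 n2)
      linarith
  rw [dist_comm (Q (S q) (T y) t) (S p), dist_comm (Q (S q) (T y) t) (T x)] at h1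
  rw [dist_comm (Q (S q) (T y) t) (S p)] at h2
  rw [dist_comm (Q (S q) (T y) t) (T x)] at h3
  have e1 := mul_le_mul_of_nonneg_left h2 ht0
  have e2 := mul_le_mul_of_nonneg_left h3 ht2
  have e3 := mul_le_mul_of_nonneg_left key (mul_nonneg ht0 ht2)
  have e4 := mul_le_mul_of_nonneg_left b1 (sq_nonneg t)
  have e5 := mul_le_mul_of_nonneg_left b2 (sq_nonneg (1 - t))
  rw [dist_comm (Q (S p) (T x) t)] at h1 ⊢
  linarith
end

section
/- Let (X,d) be a metric space carrying a map Q : X × X × [0,1] → X satisfying the CAT(0) inequality, and let S, T : X → X satisfy d(Sx,Sy) ≤ K_S·d(x,y) and d(Tx,Ty) ≤ K_T·d(x,y) for all x, y ∈ X, where K_S, K_T > 0. Then for every n ≥ 1, all p, q, x, y ∈ X and t ∈ [0,1], d(Q_t(Sⁿp,Tⁿx), Q_t(Sⁿq,Tⁿy))² ≤ (t²K_S^{2n} + (1−t)²K_T^{2n})·max(d(p,q)², d(x,y)²) + t(1−t)·( d(Sⁿp,Tⁿy) + d(Sⁿq,Tⁿy) + d(Tⁿx,Sⁿq) + d(Sⁿp,Tⁿx)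 )·min( K_S^n·d(p,q), K_T^n·d(x,y) ), where Sⁿ and Tⁿ denote the n-fold iterates of S and T. -/
theorem iterate_lip {X : Type*} [MetricSpace X] (S : X → X) (K : ℝ) (hK : 0 < K)
    (hS : ∀ x y : X, dist (S x) (S y) ≤ K * dist x y) (n : ℕ) (x y : X) :
    dist (S^[n] x) (S^[n] y) ≤ K ^ n * dist x y := by
  induction n with
  | zero => simp
  | succ k ih =>
    rw [Function.iterate_succ_apply', Function.iterate_succ_apply', pow_succ']
    calc _ ≤ K * dist (S^[k] x) (S^[k] y) := hS _ _
      _ ≤ K * (K ^ k * dist x y) := by gcongr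
      _ = _ := by ring

theorem sq_sub_sq_le {a b c : ℝ} (ha : 0 ≤ a) (hb : 0 ≤ b) (h : a ≤ b + c) :
    a ^ 2 - b ^ 2 ≤ (a + b) * c := by
  nlinarith [mul_le_mul_of_nonneg_left h (add_nonneg ha hb)]

/-- Proposition 3.1 (ii), with n-fold iterates. -/
theorem stmt_7 {X : Type*} [MetricSpace X] (Q : X → X → ℝ → X)
    (hQ : ∀ (x y z : X) (t : ℝ), 0 ≤ t → t ≤ 1 →
      dist (Q x y t) z ^ 2 ≤ t * dist z x ^ 2 + (1 - t) * dist z y ^ 2 - t * (1 - t) * dist x y ^ 2)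
    (S T : X → X) (KS KT : ℝ) (hKS : 0 < KS) (hKT : 0 < KT)
    (hS : ∀ x y : X, dist (S x) (S y) ≤ KS * dist x y)
    (hT : ∀ x y : X, dist (T x) (T y) ≤ KT * dist x y)
    (n : ℕ) (hn : 1 ≤ n) (p q x y : X) (t : ℝ) (ht0 : 0 ≤ t) (ht1 : t ≤ 1) :
    dist (Q (S^[n] p) (T^[n] x) t) (Q (S^[n] q) (T^[n] y) t) ^ 2 ≤
      (t ^ 2 * KS ^ (2 * n) + (1 - t) ^ 2 * KT ^ (2 * n)) * max (dist p q ^ 2) (dist x y ^ 2) +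
        t * (1 - t) *
          (dist (S^[n] p) (T^[n] y) + dist (S^[n] q) (T^[n] y) +
            dist (T^[n] x) (S^[n] q) + dist (S^[n] p) (T^[n] x)) *
          min (KS ^ n * dist p q) (KT ^ n * dist x y) := by
  have h1 := iterate_lip S KS hKS hS n p q
  have h2 := iterate_lip T KT hKT hT n x y
  generalize S^[n] p = a at *
  generalize S^[n] q = c at *
  generalize T^[n] x = b at *
  generalize T^[n] y = e at *
  have u1 := hQ a b (Q c e t) t ht0 ht1
  have u2 := hQ c e a t ht0 ht1
  have u3 := hQ c e b t ht0 ht1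
  have hs : 0 ≤ 1 - t := by linarith
  have k2 := mul_le_mul_of_nonneg_left u2 ht0
  have k3 := mul_le_mul_of_nonneg_left u3 hs
  have key : dist a e ^ 2 + dist b c ^ 2 - dist a b ^ 2 - dist c e ^ 2 ≤
      (dist a e + dist c e + dist b c + dist a b) * min (KS ^ n * dist p q) (KT ^ n * dist x y) := by
    have m : min (dist a c) (dist b e) ≤ min (KS ^ n * dist p q) (KT ^ n * dist x y) :=
      min_le_min h1 h2
    refine le_trans ?_ (mul_le_mul_of_nonneg_left m (by positivity))
    rcases min_choice (dist a c) (dist b e) with h | h <;> rw [h]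
    · have i1 := sq_sub_sq_le (a := dist a e) (b := dist c e) (c := dist a c) dist_nonneg dist_nonneg
        (by linarith [dist_triangle a c e])
      have i2 := sq_sub_sq_le (a := dist b c) (b := dist a b) (c := dist a c) dist_nonneg dist_nonneg
        (by linarith [dist_triangle b a c, dist_comm a b])
      linarith
    · have i1 := sq_sub_sq_le (a := dist a e) (b := dist a b) (c := dist b e) dist_nonneg dist_nonneg
        (by linarith [dist_triangle a b e])
      have i2 := sq_sub_sq_le (a := dist b c) (b := dist c e) (c := dist b e) dist_nonneg dist_nonneg
        (by linarith [dist_triangle b e c, dist_comm c e])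
      linarith
  have key2 := mul_le_mul_of_nonneg_left key (mul_nonneg ht0 hs)
  have g1 : dist a c ^ 2 ≤ KS ^ (2 * n) * max (dist p q ^ 2) (dist x y ^ 2) := by
    calc _ ≤ (KS ^ n * dist p q) ^ 2 := by gcongr
      _ = KS ^ (2 * n) * dist p q ^ 2 := by ring
      _ ≤ _ := by gcongr; exact le_max_left _ _
  have g2 : dist b e ^ 2 ≤ KT ^ (2 * n) * max (dist p q ^ 2) (dist x y ^ 2) := by
    calc _ ≤ (KT ^ n * dist x y) ^ 2 := by gcongr
      _ = KT ^ (2 * n) * dist x y ^ 2 := by ring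
      _ ≤ _ := by gcongr; exact le_max_right _ _
  have g1' := mul_le_mul_of_nonneg_left g1 (sq_nonneg t)
  have g2' := mul_le_mul_of_nonneg_left g2 (sq_nonneg (1 - t))
  rw [dist_comm (Q c e t) a, dist_comm (Q c e t) b] at u1
  rw [dist_comm (Q c e t) a] at k2
  rw [dist_comm (Q c e t) b] at k3
  linarith
end

section
/- Let (X,d) be a metric space carrying a map Q : X × X × [0,1] → X satisfying the CAT(0) inequality, let S, T : X → X satisfy d(Sx,Sy) ≤ K_S·d(x,y) and d(Tx,Ty) ≤ K_T·d(x,y) for all x, y ∈ X with K_S, K_T > 0, fix t ∈ [0,1], and let a sequence (x_n) in X satisfy the iterative scheme x_{n+2} = Q_t(S x_{n+1}, T x_n) for all n ≥ 0 (with arbitrary initial points x₀, x₁ ∈ X). Then for every n ≥ 0, d(x_{n+3}, x_{n+2})² ≤ (t²K_S² + (1−t)²K_T²)·max( d(x_{n+2},x_{n+1})², d(x_{n+1},x_n)² ) + t(1−t)·( d(Sx_{n+2},Tx_n) + d(Sx_{n+1},Tx_n) + d(Tx_{n+1},Sx_{n+1}) + d(Sx_{n+2},Tx_{n+1}) )·min(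 K_S·d(x_{n+2},x_{n+1}), K_T·d(x_{n+1},x_n) ). -/
/-- the per-step estimate for the iterative scheme x_{n+2} = Q_t(S x_{n+1}, T x_n). -/
theorem stmt_13 {X : Type*} [MetricSpace X] (Q : X → X → ℝ → X)
    (hQ : ∀ (x y z : X) (t : ℝ), 0 ≤ t → t ≤ 1 →
      dist (Q x y t) z ^ 2 ≤ t * dist z x ^ 2 + (1 - t) * dist z y ^ 2 - t * (1 - t) * dist x y ^ 2)
    (S T : X → X) (KS KT : ℝ) (hKS : 0 < KS) (hKT : 0 < KT)
    (hS : ∀ x y : X, dist (S x) (S y) ≤ KS * dist x y)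
    (hT : ∀ x y : X, dist (T x) (T y) ≤ KT * dist x y)
    (t : ℝ) (ht0 : 0 ≤ t) (ht1 : t ≤ 1)
    (x : ℕ → X) (hrec : ∀ n : ℕ, x (n + 2) = Q (S (x (n + 1))) (T (x n)) t)
    (n : ℕ) :
    dist (x (n + 3)) (x (n + 2)) ^ 2 ≤
      (t ^ 2 * KS ^ 2 + (1 - t) ^ 2 * KT ^ 2) *
          max (dist (x (n + 2)) (x (n + 1)) ^ 2) (dist (x (n + 1)) (x n) ^ 2) +
        t * (1 - t) *
          (dist (S (x (n + 2))) (T (x n)) + dist (S (x (n + 1))) (T (x n)) +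
            dist (T (x (n + 1))) (S (x (n + 1))) + dist (S (x (n + 2))) (T (x (n + 1)))) *
          min (KS * dist (x (n + 2)) (x (n + 1))) (KT * dist (x (n + 1)) (x n)) := by
  have r1 : x (n + 3) = Q (S (x (n + 2))) (T (x (n + 1))) t := hrec (n + 1)
  have r2 := hrec n
  have hac := hS (x (n + 2)) (x (n + 1))
  have hbe := hT (x (n + 1)) (x n)
  have h1 := hQ (S (x (n + 2))) (T (x (n + 1))) (x (n + 2)) t ht0 ht1
  have h2 := hQ (S (x (n + 1))) (T (x n)) (S (x (n + 2))) t ht0 ht1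
  have h3 := hQ (S (x (n + 1))) (T (x n)) (T (x (n + 1))) t ht0 ht1
  rw [← r1] at h1
  rw [← r2] at h2 h3
  have hu0 : 0 ≤ dist (x (n + 2)) (x (n + 1)) := dist_nonneg
  have hv0 : 0 ≤ dist (x (n + 1)) (x n) := dist_nonneg
  generalize dist (x (n + 2)) (x (n + 1)) = u at *
  generalize dist (x (n + 1)) (x n) = v at *
  generalize x (n + 3) = p at *
  generalize x (n + 2) = q at *
  generalize S q = a at *
  generalize T (x (n + 1)) = b at *
  generalize S (x (n + 1)) = c at *
  generalize T (x n) = e at *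
  have t1 : dist a e ≤ dist a c + dist c e := dist_triangle _ _ _
  have t2 : dist b c ≤ dist a b + dist a c := by
    have := dist_triangle b a c
    rwa [dist_comm b a] at this
  have t3 : dist a e ≤ dist a b + dist b e := dist_triangle _ _ _
  have t4 : dist b c ≤ dist b e + dist c e := by
    have := dist_triangle b e c
    rwa [dist_comm e c] at this
  have n1 : 0 ≤ dist a e := dist_nonneg
  have n2 : 0 ≤ dist c e := dist_nonneg
  have n3 : 0 ≤ dist b c := dist_nonneg
  have n4 : 0 ≤ dist a b := dist_nonneg
  have n5 : 0 ≤ dist a c := dist_nonneg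
  have n6 : 0 ≤ dist b e := dist_nonneg
  generalize dist a e = ae at *
  generalize dist c e = ce at *
  generalize dist b c = bc at *
  generalize dist a b = ab at *
  generalize dist a c = ac at *
  generalize dist b e = be at *
  have key : ae ^ 2 + bc ^ 2 - ce ^ 2 - ab ^ 2 ≤ (ae + ce + bc + ab) * min (KS * u) (KT * v) := by
    rcases min_choice (KS * u) (KT * v) with h | h <;> rw [h]
    · nlinarith [mul_le_mul_of_nonneg_left (show ae - ce ≤ KS * u by linarith) (add_nonneg n1 n2),
        mul_le_mul_of_nonneg_left (show bc - ab ≤ KS * u by linarith) (add_nonneg n3 n4)]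
    · nlinarith [mul_le_mul_of_nonneg_left (show ae - ab ≤ KT * v by linarith) (add_nonneg n1 n4),
        mul_le_mul_of_nonneg_left (show bc - ce ≤ KT * v by linarith) (add_nonneg n3 n2)]
  have s0 : 0 ≤ 1 - t := by linarith
  have key2 := mul_le_mul_of_nonneg_left key (mul_nonneg ht0 s0)
  have k1 : ac ^ 2 ≤ KS ^ 2 * max (u ^ 2) (v ^ 2) := by
    calc ac ^ 2 ≤ (KS * u) ^ 2 := by gcongr
      _ = KS ^ 2 * u ^ 2 := by ring
      _ ≤ _ := by gcongr; exact le_max_left _ _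
  have k2 : be ^ 2 ≤ KT ^ 2 * max (u ^ 2) (v ^ 2) := by
    calc be ^ 2 ≤ (KT * v) ^ 2 := by gcongr
      _ = KT ^ 2 * v ^ 2 := by ring
      _ ≤ _ := by gcongr; exact le_max_right _ _
  have k1' := mul_le_mul_of_nonneg_left k1 (sq_nonneg t)
  have k2' := mul_le_mul_of_nonneg_left k2 (sq_nonneg (1 - t))
  have h2' := mul_le_mul_of_nonneg_left h2 ht0
  have h3' := mul_le_mul_of_nonneg_left h3 s0
  linarith
end
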